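/- Let N ≥ 2 be an even integer, k = N/2, and let ϑ > 0. Then there exist m > 1 and a constant C > 0 depending only on m, N and ϑ such that for every v ∈ X_1, ( ∫₀¹ r^ϑ |v'(r)|^m dr )^{1/m} ≤ C · ‖v‖_{X_1}. -/

import Mathlib

open MeasureTheory Real Set Filter
open scoped ENNReal

/-- Surface area of the unit sphere in `ℝ^N` (equals `N` times the volume of the unit ball). -/
noncomputable def omegaS (N : ℕ) : ℝ :=
  N * (volume (Metric.ball (0 : EuclideanSpace ℝ (Fin N)) 1)).toReal

/-- The normalising constant `c_N = ω_{N-1} · binom(N,k) / N`. -/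
noncomputable def cN (N k : ℕ) : ℝ := omegaS N * (N.choose k) / N

/-- The critical constant `μ_N = N · (ω_{N-1} · binom(N-1,k-1) / k)^{2/N}`. -/
noncomputable def muN (N k : ℕ) : ℝ :=
  N * (omegaS N * ((N - 1).choose (k - 1)) / k) ^ ((2 : ℝ) / N)

/-- Membership in the weighted space `X₁`: `v` is locally absolutely continuous on `(0,1)`
with derivative `v'` (in the sense of the fundamental theorem of calculus),
`v(r) → 0` as `r → 1⁻`, and the two defining weighted integrals are finite. -/
structure MemX1 (N k : ℕ) (v v' : ℝ → ℝ) : Prop where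
  locAC : ∀ a ∈ Ioo (0:ℝ) 1, ∀ b ∈ Ioo (0:ℝ) 1,
    IntervalIntegrable v' volume a b ∧ v b - v a = ∫ t in a..b, v' t
  lim_one : Tendsto v (nhdsWithin 1 (Iio 1)) (nhds 0)
  grad_int : ∫⁻ r in Ioo (0:ℝ) 1, ENNReal.ofReal (r ^ (N - k) * |v' r| ^ (k + 1)) < ⊤
  fun_int : ∫⁻ r in Ioo (0:ℝ) 1, ENNReal.ofReal (r ^ (N - 1) * |v r| ^ (k + 1)) < ⊤

/-- The norm on `X₁`: `‖v‖ = (c_N ∫₀¹ r^{N-k} |v'|^{k+1} dr)^{1/(k+1)}`. -/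
noncomputable def normX1 (N k : ℕ) (v' : ℝ → ℝ) : ℝ :=
  (cN N k * ∫ r in Ioo (0:ℝ) 1, r ^ (N - k) * |v' r| ^ (k + 1)) ^ (1 / (k + 1 : ℝ))

lemma omegaS_pos {N : ℕ} (hN : 0 < N) : 0 < omegaS N := by
  have hball : 0 < (volume (Metric.ball (0 : EuclideanSpace ℝ (Fin N)) 1)).toReal :=
    ENNReal.toReal_pos (Metric.measure_ball_pos volume _ one_pos).ne' measure_ball_lt_top.ne
  have : (0 : ℝ) < N := by exact_mod_cast hN
  unfold omegaS
  positivity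

lemma cN_pos {N k : ℕ} (hN : 0 < N) (hk : k ≤ N) : 0 < cN N k := by
  have h1 := omegaS_pos hN
  have h2 : (0 : ℝ) < N.choose k := by exact_mod_cast Nat.choose_pos hk
  have h3 : (0 : ℝ) < N := by exact_mod_cast hN
  unfold cN
  positivity

lemma MemX1.aestronglyMeasurable {N k : ℕ} {v v' : ℝ → ℝ} (h : MemX1 N k v v') :
    AEStronglyMeasurable v' (volume.restrict (Ioo (0 : ℝ) 1)) := by
  have hu : Tendsto (fun n : ℕ => 1 / ((n : ℝ) + 1) / 2) atTop (nhds 0) := by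
    simpa using tendsto_one_div_add_atTop_nhds_zero_nat (𝕜 := ℝ).div_const 2
  have hb : Tendsto (fun n : ℕ => 1 - 1 / ((n : ℝ) + 1) / 2) atTop (nhds 1) := by
    simpa using hu.const_sub 1
  have hmem (n : ℕ) : 0 < 1 / ((n : ℝ) + 1) / 2 ∧ 1 / ((n : ℝ) + 1) / 2 < 1 := by
    have h1 : 1 / ((n : ℝ) + 1) ≤ 1 := by
      rw [div_le_one (by positivity)]
      linarith [n.cast_nonneg (α := ℝ)]
    exact ⟨by positivity, by linarith⟩
  refine (aecover_Ioo_of_Ioc (μ := volume) hu hb).aestronglyMeasurable fun n => ?_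
  obtain ⟨h0, h1⟩ := hmem n
  have hint := (h.locAC _ ⟨h0, h1⟩ (1 - 1 / ((n : ℝ) + 1) / 2) ⟨by linarith, by linarith⟩).1
  rw [Measure.restrict_restrict measurableSet_Ioc]
  exact hint.1.aestronglyMeasurable.mono_measure (Measure.restrict_mono inter_subset_left le_rfl)

/-- The weighted Hölder inequality comparing `∫ r^ϑ |w|^m` with `∫ r^k |w|^(k+1)`. -/
lemma lintegral_rpow_mul_abs_rpow_le {k : ℕ} {ϑ m : ℝ} (hm : 0 < m) (hmk : m < k + 1)
    {w : ℝ → ℝ} (hw : AEStronglyMeasurable w (volume.restrict (Ioo (0 : ℝ) 1))) :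
    ∫⁻ r in Ioo (0:ℝ) 1, ENNReal.ofReal (r ^ ϑ * |w r| ^ m) ≤
      (∫⁻ r in Ioo (0:ℝ) 1, ENNReal.ofReal (r ^ k * |w r| ^ (k + 1))) ^ (m / (k + 1)) *
      (∫⁻ r in Ioo (0:ℝ) 1, ENNReal.ofReal
        (r ^ ((ϑ - k * m / (k + 1)) * ((k + 1) / (k + 1 - m))))) ^ ((k + 1 - m) / (k + 1)) := by
  have hk1 : (0 : ℝ) < k + 1 := by positivity
  have hd : 0 < (k : ℝ) + 1 - m := by linarith
  have hpq : ((k + 1) / m : ℝ).HolderConjugate ((k + 1) / (k + 1 - m)) := by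
    rw [Real.holderConjugate_iff]
    refine ⟨by rwa [lt_div_iff₀ hm, one_mul], ?_⟩
    field_simp
    ring
  have hwm : AEMeasurable w (volume.restrict (Ioo (0 : ℝ) 1)) := hw.aemeasurable
  have holder := ENNReal.lintegral_mul_le_Lp_mul_Lq (volume.restrict (Ioo (0 : ℝ) 1)) hpq
    (f := fun r => ENNReal.ofReal (r ^ k * |w r| ^ (k + 1)) ^ (m / (k + 1)))
    (g := fun r => ENNReal.ofReal (r ^ (ϑ - k * m / (k + 1))))
    (by
      have : AEMeasurable (fun r => |w r|) (volume.restrict (Ioo (0 : ℝ) 1)) :=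
        continuous_abs.measurable.comp_aemeasurable hwm
      fun_prop)
    (by fun_prop)
  rw [one_div_div, one_div_div] at holder
  refine le_trans (le_of_eq ?_) (holder.trans (le_of_eq ?_))
  · refine setLIntegral_congr_fun measurableSet_Ioo fun r hr => ?_
    have hr0 : 0 < r := hr.1
    simp only [Pi.mul_apply]
    rw [ENNReal.ofReal_rpow_of_nonneg (by positivity) (by positivity),
      ← ENNReal.ofReal_mul (by positivity), Real.mul_rpow (by positivity) (by positivity),
      ← Real.rpow_natCast, ← Real.rpow_natCast, ← Real.rpow_mul hr0.le,
      ← Real.rpow_mul (abs_nonneg _), mul_right_comm, ← Real.rpow_add hr0]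
    congr 3
    · ring
    · push_cast
      field_simp
  · congr 2
    · refine lintegral_congr fun r => ?_
      rw [← ENNReal.rpow_mul, div_mul_div_cancel₀ hk1.ne', div_self hm.ne', ENNReal.rpow_one]
    · refine setLIntegral_congr_fun measurableSet_Ioo fun r hr => ?_
      have hr0 : 0 < r := hr.1
      rw [ENNReal.ofReal_rpow_of_nonneg (by positivity) (by positivity),
        ← Real.rpow_mul hr0.le]

lemma lintegral_Ioo_rpow_lt_top {s : ℝ} (hs : -1 < s) :
    ∫⁻ r in Ioo (0:ℝ) 1, ENNReal.ofReal (r ^ s) < ⊤ := by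
  have h : IntegrableOn (fun r : ℝ => r ^ s) (Ioo 0 1) :=
    (intervalIntegral.integrableOn_Ioo_rpow_iff one_pos).2 hs
  exact h.lintegral_lt_top

lemma MemX1.ofReal_integral_eq {N k : ℕ} {v v' : ℝ → ℝ} (h : MemX1 N k v v') :
    ENNReal.ofReal (∫ r in Ioo (0:ℝ) 1, r ^ (N - k) * |v' r| ^ (k + 1)) =
      ∫⁻ r in Ioo (0:ℝ) 1, ENNReal.ofReal (r ^ (N - k) * |v' r| ^ (k + 1)) := by
  have hnn : 0 ≤ᵐ[volume.restrict (Ioo (0:ℝ) 1)]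
      fun r => r ^ (N - k) * |v' r| ^ (k + 1) := by
    filter_upwards [ae_restrict_mem measurableSet_Ioo] with r hr
    have := hr.1
    simp only [Pi.zero_apply]
    positivity
  have hmeas : AEStronglyMeasurable (fun r => r ^ (N - k) * |v' r| ^ (k + 1))
      (volume.restrict (Ioo (0:ℝ) 1)) :=
    (continuous_pow _).aestronglyMeasurable.mul (h.aestronglyMeasurable.norm.pow _)
  refine ofReal_integral_eq_lintegral_ofReal ⟨hmeas, ?_⟩ hnn
  rw [hasFiniteIntegral_iff_ofReal hnn]
  exact h.grad_int

theorem stmt11 (N k : ℕ) (hk : 0 < k) (hN : N = 2 * k) (ϑ : ℝ) (hϑ : 0 < ϑ) :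
    ∃ m : ℝ, 1 < m ∧ ∃ C > (0:ℝ), ∀ v v' : ℝ → ℝ, MemX1 N k v v' →
      (∫⁻ r in Ioo (0:ℝ) 1, ENNReal.ofReal (r ^ ϑ * |v' r| ^ m)) ^ (1 / m) ≤
        ENNReal.ofReal (C * normX1 N k v') := by
  have hk' : (0 : ℝ) < k := by exact_mod_cast hk
  obtain ⟨m, hm1, hm⟩ := exists_between (show (1 : ℝ) < min (1 + ϑ) (k + 1) from
    lt_min (by linarith) (by linarith))
  obtain ⟨hmϑ, hmk⟩ := lt_min_iff.1 hm
  have hm0 : 0 < m := by linarith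
  have hk1 : (0 : ℝ) < k + 1 := by positivity
  have hd : 0 < (k : ℝ) + 1 - m := by linarith
  have hc : 0 < cN N k := cN_pos (by omega) (by omega)
  have hs : -1 < (ϑ - k * m / (k + 1)) * ((k + 1) / (k + 1 - m)) := by
    have : (ϑ - k * m / (k + 1)) * ((k + 1) / (k + 1 - m)) =
        (ϑ * (k + 1) - k * m) / (k + 1 - m) := by field_simp
    rw [this, lt_div_iff₀ hd]
    nlinarith
  have hK := lintegral_Ioo_rpow_lt_top hs
  set K := ∫⁻ r in Ioo (0:ℝ) 1,
    ENNReal.ofReal (r ^ ((ϑ - k * m / (k + 1)) * ((k + 1) / (k + 1 - m)))) with hKdef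
  have hKle : K ≤ ENNReal.ofReal (K.toReal + 1) :=
    (ENNReal.ofReal_toReal hK.ne).symm.le.trans (ENNReal.ofReal_le_ofReal (by linarith))
  have hK0 : 0 < K.toReal + 1 := by positivity
  refine ⟨m, hm1, (K.toReal + 1) ^ ((k + 1 - m) / (k + 1) * (1 / m)) *
    (cN N k ^ (1 / (k + 1 : ℝ)))⁻¹, by positivity, fun v v' h => ?_⟩
  have hG := h.ofReal_integral_eq
  have hG0 : 0 ≤ ∫ r in Ioo (0:ℝ) 1, r ^ (N - k) * |v' r| ^ (k + 1) :=
    setIntegral_nonneg measurableSet_Ioo fun r hr => by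
      have := hr.1
      positivity
  have holder := lintegral_rpow_mul_abs_rpow_le (ϑ := ϑ) hm0 hmk h.aestronglyMeasurable
  unfold normX1
  rw [show N - k = k by omega] at hG hG0 ⊢
  rw [← hG, ← hKdef] at holder
  set G := ∫ r in Ioo (0:ℝ) 1, r ^ k * |v' r| ^ (k + 1)
  calc _ ≤ (ENNReal.ofReal G ^ (m / (k + 1)) *
        ENNReal.ofReal (K.toReal + 1) ^ ((k + 1 - m) / (k + 1))) ^ (1 / m) := by
        refine ENNReal.rpow_le_rpow (holder.trans ?_) (by positivity)
        gcongr
    _ = _ := by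
        rw [ENNReal.mul_rpow_of_nonneg _ _ (by positivity), ← ENNReal.rpow_mul,
          ← ENNReal.rpow_mul, ENNReal.ofReal_rpow_of_nonneg hG0 (by positivity),
          ENNReal.ofReal_rpow_of_nonneg hK0.le (by positivity),
          ← ENNReal.ofReal_mul (by positivity), Real.mul_rpow hc.le hG0,
          show m / (k + 1) * (1 / m) = 1 / ((k : ℝ) + 1) by field_simp]
        congr 1
        have := (Real.rpow_pos_of_pos hc (1 / (k + 1 : ℝ))).ne'
        field_simp
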